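/- Let d ≥ 1 and L ≥ 2 be integers, let p ≥ 1, and let i_1, …, i_p ∈ {1, …, d}. Define f_1, …, f_p : ℝ^d → ℝ recursively by f_1(x) = x_{i_1} and f_{j+1}(x) = m_L(x_{i_{j+1}}, f_j(x)) for 1 ≤ j ≤ p − 1. Then for every x ∈ [−1,1]^d one has |f_p(x)| ≤ 1 and |x_{i_1}·x_{i_2}·⋯·x_{i_p} − f_p(x)| ≤ (p − 1)·2^{−2(L−1)}. -/

import Mathlib

/-- The hat function `g`. -/
noncomputable def hatg (x : ℝ) : ℝ :=
  if 0 ≤ x ∧ x ≤ 1/2 then 2*x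
  else if 1/2 < x ∧ x ≤ 1 then 2*(1-x)
  else 0

/-- `ŝ_L(x) = |x| − Σ_{ℓ=1}^{L−1} 2^{−2ℓ} g_ℓ(|x|)`. -/
noncomputable def sHat (L : ℕ) (x : ℝ) : ℝ :=
  |x| - ∑ ℓ ∈ Finset.Icc 1 (L-1), (2:ℝ)^(-(2*(ℓ:ℤ))) * hatg^[ℓ] |x|

/-- `m_L(x,y) = 2(ŝ_L((x+y)/2) − ŝ_L(x/2) − ŝ_L(y/2))`. -/
noncomputable def mL (L : ℕ) (x y : ℝ) : ℝ :=
  2 * (sHat L ((x + y)/2) - sHat L (x/2) - sHat L (y/2))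

theorem hatg_of_le_half {t : ℝ} (h0 : 0 ≤ t) (h1 : t ≤ 1 / 2) : hatg t = 2 * t :=
  if_pos ⟨h0, h1⟩

theorem hatg_of_half_le {t : ℝ} (h0 : 1 / 2 ≤ t) (h1 : t ≤ 1) : hatg t = 2 * (1 - t) := by
  rcases h0.eq_or_lt with rfl | h
  · norm_num [hatg]
  · rw [hatg, if_neg (fun h' => absurd h'.2 (not_le.2 h)), if_pos ⟨h, h1⟩]

theorem hatg_mem_Icc {t : ℝ} (ht : t ∈ Set.Icc (0 : ℝ) 1) : hatg t ∈ Set.Icc (0 : ℝ) 1 := by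
  obtain ⟨h0, h1⟩ := ht
  rcases le_total t (1 / 2) with h | h
  · rw [hatg_of_le_half h0 h]
    constructor <;> linarith
  · rw [hatg_of_half_le h h1]
    constructor <;> linarith

theorem hatg_one_sub {t : ℝ} (ht : t ∈ Set.Icc (0 : ℝ) 1) : hatg (1 - t) = hatg t := by
  obtain ⟨h0, h1⟩ := ht
  rcases le_total t (1 / 2) with h | h
  · rw [hatg_of_le_half h0 h, hatg_of_half_le (by linarith) (by linarith)]
    ring
  · rw [hatg_of_half_le h h1, hatg_of_le_half (by linarith) (by linarith)]

/-- On `[0, 1]`, the piecewise linear interpolant of `t ↦ t ^ 2` at the multiples of `2⁻ⁿ`. -/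
noncomputable def sqInterp : ℕ → ℝ → ℝ
  | 0, t => t
  | n + 1, t => t - hatg t / 2 + sqInterp n (hatg t) / 4

theorem sqInterp_eq_sub_sum (n : ℕ) (t : ℝ) :
    sqInterp n t = t - ∑ k ∈ Finset.range n, (1 / 4 : ℝ) ^ (k + 1) * hatg^[k + 1] t := by
  induction n generalizing t with
  | zero => simp [sqInterp]
  | succ n ih =>
    have h : ∑ k ∈ Finset.range n, (1 / 4 : ℝ) ^ (k + 1 + 1) * hatg^[k + 1 + 1] t =
        1 / 4 * ∑ k ∈ Finset.range n, (1 / 4 : ℝ) ^ (k + 1) * hatg^[k + 1] (hatg t) := by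
      rw [Finset.mul_sum]
      refine Finset.sum_congr rfl fun k _ => ?_
      rw [Function.iterate_succ_apply hatg (k + 1) t, pow_succ _ (k + 1)]
      ring
    rw [sqInterp, ih, Finset.sum_range_succ', h]
    simp only [zero_add, pow_one, Function.iterate_one]
    ring

theorem two_zpow_neg_two_mul (n : ℕ) : (2 : ℝ) ^ (-(2 * (n : ℤ))) = (1 / 4) ^ n := by
  rw [zpow_neg, zpow_mul, zpow_natCast, one_div, inv_pow]
  norm_num

theorem sHat_succ (n : ℕ) (x : ℝ) : sHat (n + 1) x = sqInterp n |x| := by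
  rw [sHat, sqInterp_eq_sub_sum, Nat.add_sub_cancel, Finset.range_eq_Ico,
    Finset.sum_Ico_add' (fun k => (1 / 4 : ℝ) ^ k * hatg^[k] |x|) 0 n 1]
  congr 1
  exact Finset.sum_congr rfl fun k _ => by rw [two_zpow_neg_two_mul]

theorem sqInterp_sub_sq_mem_Icc (n : ℕ) {t : ℝ} (ht : t ∈ Set.Icc (0 : ℝ) 1) :
    sqInterp n t - t ^ 2 ∈ Set.Icc 0 ((1 / 4 : ℝ) ^ n / 4) := by
  induction n generalizing t with
  | zero =>
    obtain ⟨h0, h1⟩ := ht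
    rw [sqInterp, pow_zero]
    constructor <;> nlinarith [sq_nonneg (t - 1 / 2)]
  | succ n ih =>
    obtain ⟨hl, hu⟩ := ih (hatg_mem_Icc ht)
    have h : t - hatg t / 2 + hatg t ^ 2 / 4 = t ^ 2 := by
      rcases le_total t (1 / 2) with h | h
      · rw [hatg_of_le_half ht.1 h]
        ring
      · rw [hatg_of_half_le h ht.2]
        ring
    rw [sqInterp, pow_succ]
    constructor <;> linarith

theorem sqInterp_nonneg (n : ℕ) {t : ℝ} (ht : t ∈ Set.Icc (0 : ℝ) 1) : 0 ≤ sqInterp n t := by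
  linarith [(sqInterp_sub_sq_mem_Icc n ht).1, sq_nonneg t]

theorem sqInterp_le_self (n : ℕ) {t : ℝ} (ht : t ∈ Set.Icc (0 : ℝ) 1) : sqInterp n t ≤ t := by
  induction n generalizing t with
  | zero => exact le_rfl
  | succ n ih =>
    rw [sqInterp]
    linarith [ih (hatg_mem_Icc ht), (hatg_mem_Icc ht).1]

theorem sqInterp_one_sub (n : ℕ) {t : ℝ} (ht : t ∈ Set.Icc (0 : ℝ) 1) :
    sqInterp n (1 - t) = 1 - 2 * t + sqInterp n t := by
  cases n with
  | zero =>
    simp only [sqInterp]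
    ring
  | succ n =>
    rw [sqInterp, sqInterp, hatg_one_sub ht]
    ring

theorem sqInterp_succ_half (n : ℕ) {t : ℝ} (ht : t ∈ Set.Icc (0 : ℝ) 1) :
    sqInterp (n + 1) (t / 2) = sqInterp n t / 4 := by
  rw [sqInterp, hatg_of_le_half (by linarith [ht.1]) (by linarith [ht.2]),
    show 2 * (t / 2) = t by ring]
  ring

theorem sqInterp_succ_half_add_le (n : ℕ) {u v : ℝ} (hu : u ∈ Set.Icc (0 : ℝ) 1)
    (hv : v ∈ Set.Icc (0 : ℝ) 1) :
    sqInterp (n + 1) ((u + v) / 2) ≤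
      1 / 2 + sqInterp (n + 1) (u / 2) + sqInterp (n + 1) (v / 2) := by
  rw [sqInterp_succ_half n hu, sqInterp_succ_half n hv]
  have hu' := sqInterp_nonneg n hu
  have hv' := sqInterp_nonneg n hv
  obtain ⟨hu0, hu1⟩ := hu
  obtain ⟨hv0, hv1⟩ := hv
  rcases le_total (u + v) 1 with h | h
  · have hw : u + v ∈ Set.Icc (0 : ℝ) 1 := ⟨by linarith, h⟩
    rw [sqInterp_succ_half n hw]
    linarith [sqInterp_le_self n hw]
  · have ha : 1 - u ∈ Set.Icc (0 : ℝ) 1 := ⟨by linarith, by linarith⟩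
    have hb : 1 - v ∈ Set.Icc (0 : ℝ) 1 := ⟨by linarith, by linarith⟩
    have hc : 2 * (1 - (u + v) / 2) ∈ Set.Icc (0 : ℝ) 1 := ⟨by linarith, by linarith⟩
    have hu2 := sqInterp_one_sub n ha
    have hv2 := sqInterp_one_sub n hb
    rw [sub_sub_cancel] at hu2 hv2
    rw [sqInterp, hatg_of_half_le (by linarith) (by linarith)]
    linarith [sqInterp_le_self n hc, sqInterp_nonneg n ha, sqInterp_nonneg n hb]

theorem abs_mem_Icc_zero_one {x : ℝ} (hx : |x| ≤ 1) : |x| ∈ Set.Icc (0 : ℝ) 1 :=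
  ⟨abs_nonneg x, hx⟩

theorem abs_half_add_le_one {x y : ℝ} (hx : |x| ≤ 1) (hy : |y| ≤ 1) : |(x + y) / 2| ≤ 1 := by
  rw [abs_le] at *
  constructor <;> linarith

theorem abs_half_eq (x : ℝ) : |x / 2| = |x| / 2 := by
  rw [abs_div, abs_two]

theorem abs_mL_le_one (n : ℕ) {x y : ℝ} (hx : |x| ≤ 1) (hy : |y| ≤ 1) :
    |mL (n + 2) x y| ≤ 1 := by
  have hx' := abs_mem_Icc_zero_one hx
  have hy' := abs_mem_Icc_zero_one hy
  have hxu := sqInterp_succ_half n hx'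
  have hyu := sqInterp_succ_half n hy'
  have hw := sqInterp_nonneg (n + 1) (abs_mem_Icc_zero_one (abs_half_add_le_one hx hy))
  have hx1 := sqInterp_le_self n hx'
  have hy1 := sqInterp_le_self n hy'
  have hx0 := sqInterp_nonneg n hx'
  have hy0 := sqInterp_nonneg n hy'
  have hub : sqInterp (n + 1) |(x + y) / 2| ≤
      1 / 2 + sqInterp (n + 1) (|x| / 2) + sqInterp (n + 1) (|y| / 2) := by
    rcases le_total 0 (x * y) with h | h
    · rw [abs_half_eq, (abs_add_eq_add_abs_iff x y).2 (mul_nonneg_iff.1 h)]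
      exact sqInterp_succ_half_add_le n hx' hy'
    · have hs : |x + y| ≤ 1 := by
        rw [abs_le] at hx hy ⊢
        rcases mul_nonpos_iff.1 h with h | h <;> constructor <;> linarith
      rw [abs_half_eq, sqInterp_succ_half n (abs_mem_Icc_zero_one hs)]
      linarith [sqInterp_le_self n (abs_mem_Icc_zero_one hs)]
  rw [mL, sHat_succ, sHat_succ, sHat_succ, abs_half_eq x, abs_half_eq y, abs_le]
  constructor <;> linarith

theorem abs_mul_sub_mL_le (n : ℕ) {x y : ℝ} (hx : |x| ≤ 1) (hy : |y| ≤ 1) :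
    |x * y - mL (n + 1) x y| ≤ (1 / 4 : ℝ) ^ n := by
  have half_le {z : ℝ} (hz : |z| ≤ 1) : |z / 2| ≤ 1 := by
    rw [abs_half_eq]
    linarith [abs_nonneg z]
  obtain ⟨hw0, hw1⟩ :=
    sqInterp_sub_sq_mem_Icc n (abs_mem_Icc_zero_one (abs_half_add_le_one hx hy))
  obtain ⟨hx0, hx1⟩ := sqInterp_sub_sq_mem_Icc n (abs_mem_Icc_zero_one (half_le hx))
  obtain ⟨hy0, hy1⟩ := sqInterp_sub_sq_mem_Icc n (abs_mem_Icc_zero_one (half_le hy))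
  rw [sq_abs] at hw0 hw1 hx0 hx1 hy0 hy1
  have hn : (0 : ℝ) ≤ (1 / 4) ^ n := by positivity
  rw [mL, sHat_succ, sHat_succ, sHat_succ, abs_le]
  constructor <;> linarith

/-- Lemma on the recursive approximation of monomials: with `f 0 x = x (idx 0)` and
`f (j+1) x = m_L(x_{idx (j+1)}, f j x)`, the value `f (p-1)` approximates the product
`x_{idx 0} ⋯ x_{idx (p-1)}` and is bounded by `1` on `[-1,1]^d`. -/
theorem stmt12 (d L p : ℕ) (hd : 1 ≤ d) (hL : 2 ≤ L) (hp : 1 ≤ p)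
    (idx : ℕ → Fin d) (f : ℕ → (Fin d → ℝ) → ℝ)
    (hf0 : ∀ x, f 0 x = x (idx 0))
    (hfs : ∀ j, j + 1 < p → ∀ x, f (j+1) x = mL L (x (idx (j+1))) (f j x)) :
    ∀ x : Fin d → ℝ, (∀ k, x k ∈ Set.Icc (-1:ℝ) 1) →
      |f (p-1) x| ≤ 1 ∧
      |(∏ j ∈ Finset.range p, x (idx j)) - f (p-1) x|
        ≤ ((p:ℝ) - 1) * (2:ℝ)^(-(2*((L:ℤ)-1))) := by
  intro x hx
  obtain ⟨n, rfl⟩ := Nat.exists_eq_add_of_le' hL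
  have hx' : ∀ k, |x k| ≤ 1 := fun k => abs_le.2 (hx k)
  have hpow : (2 : ℝ) ^ (-(2 * (((n + 2 : ℕ) : ℤ) - 1))) = (1 / 4) ^ (n + 1) := by
    rw [← two_zpow_neg_two_mul]
    congr 1
    push_cast
    ring
  have key : ∀ j, j < p → |f j x| ≤ 1 ∧
      |(∏ i ∈ Finset.range (j + 1), x (idx i)) - f j x| ≤ j * (1 / 4 : ℝ) ^ (n + 1) := by
    intro j
    induction j with
    | zero => simp [hf0, hx']
    | succ j ih =>
      intro hj
      obtain ⟨hb, he⟩ := ih (Nat.lt_of_succ_lt hj)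
      rw [hfs j hj, Finset.prod_range_succ]
      refine ⟨abs_mL_le_one n (hx' _) hb, ?_⟩
      set P := ∏ i ∈ Finset.range (j + 1), x (idx i)
      set z := x (idx (j + 1))
      calc |P * z - mL (n + 2) z (f j x)|
          = |z * (P - f j x) + (z * f j x - mL (n + 2) z (f j x))| := by ring_nf
        _ ≤ |z| * |P - f j x| + |z * f j x - mL (n + 2) z (f j x)| := by
          rw [← abs_mul]
          exact abs_add_le _ _
        _ ≤ 1 * (j * (1 / 4 : ℝ) ^ (n + 1)) + (1 / 4 : ℝ) ^ (n + 1) := by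
          gcongr
          · exact hx' _
          · exact abs_mul_sub_mL_le (n + 1) (hx' _) hb
        _ = ((j + 1 : ℕ) : ℝ) * (1 / 4 : ℝ) ^ (n + 1) := by
          push_cast
          ring
  obtain ⟨q, rfl⟩ := Nat.exists_eq_add_of_le' hp
  rw [hpow]
  simpa only [Nat.add_sub_cancel, Nat.cast_add, Nat.cast_one, add_sub_cancel_right]
    using key q (Nat.lt_succ_self q)
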